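/- For all n ≥ 2, the number of permutations π ∈ S_n such that both π and θ(π) avoid the pattern 213 satisfies t_n(213) = 2·F_{n+2} + n² − 6n + 4 (an identity of integers). -/

import Mathlib

/-- The one-line word of the image of `π` under the fundamental bijection:
write `π` in standard cycle form (every cycle written with its largest element
first, cycles listed in increasing order of their largest elements) and erase
the parentheses.  The cycle maxima are exactly the `x` with `π^[k] x ≤ x` for
all `k`, and the cycle of `x` is `x, π x, π² x, …` up to the period of `x`. -/
noncomputable def fundWord {n : ℕ} (π : Equiv.Perm (Fin n)) : List (Fin n) :=
  ((List.finRange n).filter fun x => (List.range n).all fun k => decide ((⇑π)^[k] x ≤ x)).flatMap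
    fun x => (List.range (Function.minimalPeriod (⇑π) x)).map fun k => (⇑π)^[k] x

/-- The permutation whose one-line notation is the word `w`
(junk value if `w` is not the one-line notation of a permutation). -/
noncomputable def permOfWord {n : ℕ} (w : List (Fin n)) : Equiv.Perm (Fin n) :=
  Function.invFun (fun σ : Equiv.Perm (Fin n) => (List.finRange n).map ⇑σ) w

/-- The fundamental bijection `θ`. -/
noncomputable def theta {n : ℕ} (π : Equiv.Perm (Fin n)) : Equiv.Perm (Fin n) :=
  permOfWord (fundWord π)

/-- `π` contains the pattern `σ`. -/
def Contains {k n : ℕ} (σ : Equiv.Perm (Fin k)) (π : Equiv.Perm (Fin n)) : Prop :=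
  ∃ f : Fin k → Fin n, StrictMono f ∧ ∀ a b : Fin k, π (f a) < π (f b) ↔ σ a < σ b

/-- `π` avoids the pattern `σ`. -/
def Avoids {k n : ℕ} (π : Equiv.Perm (Fin n)) (σ : Equiv.Perm (Fin k)) : Prop :=
  ¬ Contains σ π

noncomputable def p123 : Equiv.Perm (Fin 3) := Equiv.ofBijective ![0, 1, 2] (by decide)
noncomputable def p132 : Equiv.Perm (Fin 3) := Equiv.ofBijective ![0, 2, 1] (by decide)
noncomputable def p213 : Equiv.Perm (Fin 3) := Equiv.ofBijective ![1, 0, 2] (by decide)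
noncomputable def p231 : Equiv.Perm (Fin 3) := Equiv.ofBijective ![1, 2, 0] (by decide)
noncomputable def p312 : Equiv.Perm (Fin 3) := Equiv.ofBijective ![2, 0, 1] (by decide)
noncomputable def p321 : Equiv.Perm (Fin 3) := Equiv.ofBijective ![2, 1, 0] (by decide)

/-- The direct sum `π ⊕ τ` of two permutations. -/
def directSum {n m : ℕ} (π : Equiv.Perm (Fin n)) (τ : Equiv.Perm (Fin m)) :
    Equiv.Perm (Fin (n + m)) :=
  finSumFinEquiv.permCongr (Equiv.sumCongr π τ)

/-- A permutation is irreducible if it is not a direct sum of two nonempty permutations. -/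
def IrreduciblePerm {n : ℕ} (π : Equiv.Perm (Fin n)) : Prop :=
  ¬ ∃ (a b : ℕ) (_ : 0 < a) (_ : 0 < b) (h : a + b = n)
      (σ : Equiv.Perm (Fin a)) (τ : Equiv.Perm (Fin b)),
      π = (finCongr h).permCongr (directSum σ τ)

/-- A permutation is cyclic if its cycle decomposition is a single cycle of full length,
i.e. it acts transitively. -/
def IsCyclicPerm {n : ℕ} (π : Equiv.Perm (Fin n)) : Prop :=
  ∀ x y : Fin n, ∃ k : ℕ, (⇑π)^[k] x = y

/-- A word avoids the pattern `213`. -/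
def WordAvoids {α : Type*} [LinearOrder α] : List α → Prop
  | [] => True
  | b :: l => l.Pairwise (fun a c => a < b → ¬ b < c) ∧ WordAvoids l

/-- `y` is the immediate successor of an occurrence of `x` in a word. -/
def Next {α : Type*} : List α → α → α → Prop
  | a :: b :: l, x, y => (x = a ∧ y = b) ∨ Next (b :: l) x y
  | _, _, _ => False

/-- A relation, seen as a set of points in the plane, avoids the pattern `213`. -/
def RelAvoids {α : Type*} [LinearOrder α] (R : α → α → Prop) : Prop :=
  ∀ ⦃i j k a b c⦄, R i a → R j b → R k c → i < j → j < k → b < a → ¬ a < c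

section Next
variable {α : Type*} {l r : List α} {a x y : α}

@[simp] theorem next_nil : ¬ Next [] x y := by simp [Next]

theorem next_cons : Next (a :: l) x y ↔ (x = a ∧ l.head? = some y) ∨ Next l x y := by
  cases l with
  | nil => simp [Next]
  | cons b l => simp [Next, eq_comm]

theorem next_append : Next (l ++ r) x y ↔
    Next l x y ∨ (l.getLast? = some x ∧ r.head? = some y) ∨ Next r x y := by
  induction l with
  | nil => simp
  | cons b l ih =>
    cases l with
    | nil => simp [next_cons, eq_comm]
    | cons c l => rw [List.cons_append, next_cons, next_cons, ih]; simp; tauto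

theorem Next.mem_left (h : Next l x y) : x ∈ l := by
  induction l with
  | nil => simp at h
  | cons b l ih => rw [next_cons] at h; grind

theorem Next.mem_right (h : Next l x y) : y ∈ l := by
  induction l with
  | nil => simp at h
  | cons b l ih => rw [next_cons] at h; grind [List.mem_of_head?]

theorem Next.mem_of_concat (h : Next (l ++ [a]) x y) : x ∈ l := by
  simp only [next_append, next_cons] at h
  rcases h with h | h | h
  · exact h.mem_left
  · exact List.mem_of_getLast? h.1
  · simp at h

theorem Next.mem_of_cons (h : Next (a :: l) x y) : y ∈ l := by
  rw [next_cons] at h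
  rcases h with h | h
  · exact List.mem_of_head? h.2
  · exact h.mem_right

end Next

section WordAvoids
variable {α : Type*} [LinearOrder α] {l r : List α} {b : α}

@[simp] theorem wordAvoids_nil : WordAvoids ([] : List α) := trivial

theorem wordAvoids_cons : WordAvoids (b :: l) ↔
    l.Pairwise (fun a c => a < b → ¬ b < c) ∧ WordAvoids l := Iff.rfl

theorem wordAvoids_append : WordAvoids (l ++ r) ↔
    WordAvoids l ∧ WordAvoids r ∧ (∀ b ∈ l, r.Pairwise (fun a c => a < b → ¬ b < c)) ∧
      ∀ c ∈ r, l.Pairwise (fun b a => a < b → ¬ b < c) := by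
  induction l with
  | nil => simp
  | cons b l ih =>
    simp only [List.cons_append, wordAvoids_cons, ih, List.pairwise_append, List.pairwise_cons,
      List.mem_cons, forall_eq_or_imp]
    grind

end WordAvoids

/-- The words `A` on the open interval `(s, t)` for which the cycle `(t A s)` and its
standard word both avoid `213`. -/
def EndsAtMin (s t : ℕ) (A : List ℕ) : Prop :=
  A.Nodup ∧ (∀ x, x ∈ A ↔ s < x ∧ x < t) ∧ WordAvoids A ∧ RelAvoids (Next (t :: (A ++ [s, t])))

/-- The words `B` on the open interval `(s, t)` for which the cycle `(t s B)` and its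
standard word both avoid `213`. -/
def StartsAtMin (s t : ℕ) (B : List ℕ) : Prop :=
  B.Nodup ∧ (∀ x, x ∈ B ↔ s < x ∧ x < t) ∧ WordAvoids B ∧ RelAvoids (Next (t :: s :: (B ++ [t])))

theorem eq_range'_of_pairwise_lt {l : List ℕ} {a n : ℕ} (hl : l.Pairwise (· < ·))
    (hm : ∀ x, x ∈ l ↔ a ≤ x ∧ x < a + n) : l = List.range' a n := by
  refine List.Perm.eq_of_pairwise (le := (· < ·)) ?_ hl List.pairwise_lt_range' ?_
  · intro a b _ _ h1 h2; omega
  · rw [List.perm_ext_iff_of_nodup (hl.imp ne_of_lt) List.nodup_range']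
    intro x; rw [hm]; simp

theorem endsAtMin_append {s t : ℕ} {X : List ℕ} (hst : s + 1 < t) :
    EndsAtMin s t (X ++ [s + 1]) ↔ EndsAtMin (s + 1) t X := by
  have key : (∀ x, x ∈ X ↔ s + 1 < x ∧ x < t) →
      (RelAvoids (Next (t :: (X ++ [s + 1] ++ [s, t]))) ↔
        RelAvoids (Next (t :: (X ++ [s + 1, t])))) := by
    intro hX
    have e1 : t :: (X ++ [s + 1] ++ [s, t]) = (t :: X ++ [s + 1]) ++ [s, t] := by simp
    have e2 : t :: (X ++ [s + 1, t]) = (t :: X ++ [s + 1]) ++ [t] := by simp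
    have b1 : ∀ x y, Next (t :: X ++ [s + 1]) x y → s + 1 < x ∧ x ≤ t ∧ s + 1 ≤ y ∧ y < t := by
      intro x y h
      have h1 := h.mem_of_concat
      have h2 := Next.mem_of_cons h
      simp only [List.append_eq, List.mem_append, List.mem_cons, List.not_mem_nil, or_false] at h1 h2
      grind
    rw [e1, e2]
    generalize hR : Next (t :: X ++ [s + 1]) = R at b1
    have r1 : ∀ x y, Next (t :: X ++ [s + 1] ++ [s, t]) x y ↔
      R x y ∨ (x = s + 1 ∧ y = s) ∨ (x = s ∧ y = t) := by
      intro x y; rw [next_append, hR]; simp [next_cons]; grind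
    have r2 : ∀ x y, Next (t :: X ++ [s + 1] ++ [t]) x y ↔
      R x y ∨ (x = s + 1 ∧ y = t) := by
      intro x y; rw [next_append, hR]; simp [next_cons]; grind
    unfold RelAvoids
    simp only [r1, r2]
    constructor
    · intro H i j k a b c; grind
    · intro H i j k a b c; grind
  constructor
  · rintro ⟨h1, h2, h3, h4⟩
    have hX : ∀ x, x ∈ X ↔ s + 1 < x ∧ x < t := by
      intro x; have := h2 x; have := h2 (s + 1); grind
    exact ⟨by grind, hX, (wordAvoids_append.1 h3).1, (key hX).1 h4⟩
  · rintro ⟨h1, hX, h3, h4⟩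
    refine ⟨by grind, by grind, ?_, (key hX).2 h4⟩
    rw [wordAvoids_append]
    refine ⟨h3, by simp [wordAvoids_cons], by simp, ?_⟩
    simp only [List.mem_singleton, forall_eq]
    exact List.pairwise_of_forall_mem_list (by grind)

theorem endsAtMin_cons_cons {s t : ℕ} {Y : List ℕ} (hst : s + 1 < t) :
    EndsAtMin s (t + 1) ((s + 1) :: t :: Y) ↔ EndsAtMin (s + 1) t Y := by
  have key : (∀ x, x ∈ Y ↔ s + 1 < x ∧ x < t) →
      (RelAvoids (Next ((t + 1) :: ((s + 1) :: t :: Y ++ [s, t + 1]))) ↔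
        RelAvoids (Next (t :: (Y ++ [s + 1, t])))) := by
    intro hY
    have e1 : (t + 1) :: ((s + 1) :: t :: Y ++ [s, t + 1]) =
      (t + 1) :: (s + 1) :: (t :: Y ++ [s, t + 1]) := by simp
    have e2 : t :: (Y ++ [s + 1, t]) = t :: Y ++ [s + 1, t] := by simp
    have b1 : ∀ x y, Next (t :: Y) x y → s + 1 < x ∧ x ≤ t ∧ s + 1 < y ∧ y < t := by
      intro x y h
      have h1 := h.mem_left
      have h2 := h.mem_of_cons
      grind
    have b2 : ∀ x, (t :: Y).getLast? = some x → s + 1 < x ∧ x ≤ t := by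
      intro x h
      have h1 := List.mem_of_getLast? h
      grind
    rw [e1, e2]
    have r1 : ∀ x y, Next ((t + 1) :: (s + 1) :: (t :: Y ++ [s, t + 1])) x y ↔
        Next (t :: Y) x y ∨ ((t :: Y).getLast? = some x ∧ y = s) ∨ (x = s ∧ y = t + 1) ∨
          (x = t + 1 ∧ y = s + 1) ∨ (x = s + 1 ∧ y = t) := by
      intro x y; rw [next_cons, next_cons, next_append]; simp [next_cons]; grind
    have r2 : ∀ x y, Next (t :: Y ++ [s + 1, t]) x y ↔
        Next (t :: Y) x y ∨ ((t :: Y).getLast? = some x ∧ y = s + 1) ∨ (x = s + 1 ∧ y = t) := by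
      intro x y; rw [next_append]; simp [next_cons]; grind
    unfold RelAvoids
    simp only [r1, r2]
    generalize Next (t :: Y) = R at *
    generalize (t :: Y).getLast? = o at *
    constructor
    · intro H i j k a b c
      have H1 := @H i j k (if a = s + 1 then s else a) (if b = s + 1 then s else b)
        (if c = s + 1 then s else c)
      clear H
      grind
    · intro H i j k a b c
      have H1 := @H i j k (if a = s then s + 1 else a) (if b = s then s + 1 else b)
        (if c = s then s + 1 else c)
      clear H
      grind
  constructor
  · rintro ⟨h1, h2, h3, h4⟩
    have hX : ∀ x, x ∈ Y ↔ s + 1 < x ∧ x < t := by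
      intro x; have := h2 x; grind
    exact ⟨by grind, hX, h3.2.2, (key hX).1 h4⟩
  · rintro ⟨h1, hX, h3, h4⟩
    refine ⟨by grind, by grind, ?_, (key hX).2 h4⟩
    simp only [wordAvoids_cons, h3, and_true]
    exact ⟨List.pairwise_of_forall_mem_list (by grind),
      List.pairwise_of_forall_mem_list (by grind)⟩

theorem startsAtMin_cons {s t : ℕ} {Y : List ℕ} (hst : s + 1 < t) :
    StartsAtMin s t ((s + 1) :: Y) ↔ StartsAtMin (s + 1) t Y := by
  have key : (∀ x, x ∈ Y ↔ s + 1 < x ∧ x < t) →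
      (RelAvoids (Next (t :: s :: ((s + 1) :: Y ++ [t]))) ↔
        RelAvoids (Next (t :: (s + 1) :: (Y ++ [t])))) := by
    intro hY
    have b1 : ∀ x y, Next ((s + 1) :: Y ++ [t]) x y →
        s + 1 ≤ x ∧ x < t ∧ s + 1 < y ∧ y ≤ t := by
      intro x y h
      have h1 := h.mem_of_concat
      have h2 := Next.mem_of_cons h
      simp only [List.append_eq, List.mem_append, List.mem_cons, List.not_mem_nil, or_false] at h1 h2
      grind
    have r1 : ∀ x y, Next (t :: s :: ((s + 1) :: Y ++ [t])) x y ↔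
        Next ((s + 1) :: Y ++ [t]) x y ∨ (x = t ∧ y = s) ∨ (x = s ∧ y = s + 1) := by
      intro x y; rw [next_cons, next_cons]; simp; grind
    have r2 : ∀ x y, Next (t :: (s + 1) :: (Y ++ [t])) x y ↔
        Next ((s + 1) :: Y ++ [t]) x y ∨ (x = t ∧ y = s + 1) := by
      intro x y; rw [next_cons]; simp; grind
    unfold RelAvoids
    simp only [r1, r2]
    generalize Next ((s + 1) :: Y ++ [t]) = R at *
    constructor
    · intro H i j k a b c
      have H1 := @H i j k (if a = s + 1 then s else a) (if b = s + 1 then s else b)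
        (if c = s + 1 then s else c)
      clear H
      grind
    · intro H i j k a b c
      have H1 := @H i j k (if a = s then s + 1 else a) (if b = s then s + 1 else b)
        (if c = s then s + 1 else c)
      clear H
      grind
  constructor
  · rintro ⟨h1, h2, h3, h4⟩
    have hX : ∀ x, x ∈ Y ↔ s + 1 < x ∧ x < t := by
      intro x; have := h2 x; grind
    exact ⟨by grind, hX, h3.2, (key hX).1 h4⟩
  · rintro ⟨h1, hX, h3, h4⟩
    refine ⟨by grind, by grind, ?_, (key hX).2 h4⟩
    simp only [wordAvoids_cons, h3, and_true]
    exact List.pairwise_of_forall_mem_list (by grind)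

theorem startsAtMin_cons_append {s t : ℕ} {Y : List ℕ} (hst : s + 1 < t) :
    StartsAtMin s (t + 1) (t :: (Y ++ [s + 1])) ↔ EndsAtMin (s + 1) t Y := by
  have key : (∀ x, x ∈ Y ↔ s + 1 < x ∧ x < t) →
      (RelAvoids (Next ((t + 1) :: s :: (t :: (Y ++ [s + 1]) ++ [t + 1]))) ↔
        RelAvoids (Next (t :: (Y ++ [s + 1, t])))) := by
    intro hY
    have e1 : (t + 1) :: s :: (t :: (Y ++ [s + 1]) ++ [t + 1]) =
      (t + 1) :: s :: ((t :: Y ++ [s + 1]) ++ [t + 1]) := by simp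
    have e2 : t :: (Y ++ [s + 1, t]) = (t :: Y ++ [s + 1]) ++ [t] := by simp
    have b1 : ∀ x y, Next (t :: Y ++ [s + 1]) x y →
        s + 1 < x ∧ x ≤ t ∧ s + 1 ≤ y ∧ y < t := by
      intro x y h
      have h1 := h.mem_of_concat
      have h2 := Next.mem_of_cons h
      simp only [List.append_eq, List.mem_append, List.mem_cons, List.not_mem_nil, or_false] at h1 h2
      grind
    rw [e1, e2]
    have r1 : ∀ x y, Next ((t + 1) :: s :: ((t :: Y ++ [s + 1]) ++ [t + 1])) x y ↔
        Next (t :: Y ++ [s + 1]) x y ∨ (x = s + 1 ∧ y = t + 1) ∨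
          (x = t + 1 ∧ y = s) ∨ (x = s ∧ y = t) := by
      intro x y; rw [next_cons, next_cons, next_append]; simp [next_cons]; grind
    have r2 : ∀ x y, Next ((t :: Y ++ [s + 1]) ++ [t]) x y ↔
        Next (t :: Y ++ [s + 1]) x y ∨ (x = s + 1 ∧ y = t) := by
      intro x y; rw [next_append]; simp [next_cons]; grind
    unfold RelAvoids
    simp only [r1, r2]
    generalize Next (t :: Y ++ [s + 1]) = R at *
    constructor
    · intro H i j k a b c
      have H1 := @H i j k a b c
      clear H
      grind
    · intro H i j k a b c
      have H1 := @H i j k a b c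
      clear H
      grind
  constructor
  · rintro ⟨h1, h2, h3, h4⟩
    have hX : ∀ x, x ∈ Y ↔ s + 1 < x ∧ x < t := by
      intro x; have := h2 x; grind
    exact ⟨by grind, hX, (wordAvoids_append.1 h3.2).1, (key hX).1 h4⟩
  · rintro ⟨h1, hX, h3, h4⟩
    refine ⟨by grind, by grind, ?_, (key hX).2 h4⟩
    simp only [wordAvoids_cons, wordAvoids_append, h3]
    simp [List.pairwise_append]
    exact ⟨⟨List.pairwise_of_forall_mem_list (by grind), by grind⟩,
      List.pairwise_of_forall_mem_list (by grind)⟩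
theorem next_range' {a n x y : ℕ} :
    Next (List.range' a n) x y ↔ a ≤ x ∧ y = x + 1 ∧ y < a + n := by
  induction n generalizing a with
  | zero => simp; omega
  | succ n ih =>
    rw [List.range'_succ, next_cons, ih]
    cases n with
    | zero => simp; omega
    | succ n => rw [List.range'_succ]; simp; omega

theorem wordAvoids_of_pairwise_lt {α : Type*} [LinearOrder α] {l : List α}
    (h : l.Pairwise (· < ·)) : WordAvoids l := by
  induction l with
  | nil => trivial
  | cons b l ih =>
    rw [List.pairwise_cons] at h
    exact ⟨List.pairwise_of_forall_mem_list fun a ha c _ h1 _ => absurd h1 (h.1 a ha).not_gt,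
      ih h.2⟩

theorem wordAvoids_of_pairwise_gt {α : Type*} [LinearOrder α] {l : List α}
    (h : l.Pairwise (· > ·)) : WordAvoids l := by
  induction l with
  | nil => trivial
  | cons b l ih =>
    rw [List.pairwise_cons] at h
    exact ⟨List.pairwise_of_forall_mem_list fun a _ c hc _ h2 => absurd h2 (h.1 c hc).not_gt,
      ih h.2⟩

theorem eq_range'_of_head_ne {u t α β y z : ℕ} {U : List ℕ} {R : ℕ → ℕ → Prop}
    (hn : U.Nodup) (hm : ∀ x, x ∈ U ↔ u < x ∧ x ≤ t) (hw : WordAvoids U) (hR : RelAvoids R)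
    (hsub : ∀ x y, Next U x y → R x y) (hy : U.head? = some y) (hz : U.getLast? = some z)
    (hα : α ≤ u) (hβ : β ≤ u) (h1 : R α y) (h2 : R z β) (hyt : y ≠ t) :
    U = List.range' (u + 1) (t - u) := by
  have hyU := (hm y).1 (List.mem_of_head? hy)
  have htU : t ∈ U := (hm t).2 ⟨by omega, le_rfl⟩
  obtain ⟨P, Q, rfl⟩ := List.append_of_mem htU
  cases P with
  | nil => simp at hy; omega
  | cons y' P =>
    obtain rfl : y' = y := by simpa using hy
    rw [wordAvoids_append] at hw
    obtain ⟨-, -, hw1, hw2⟩ := hw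
    have hinc : (y' :: P).Pairwise (· < ·) := by
      have h3 := hw2 t (by simp)
      have h4 : (y' :: P).Nodup := (List.nodup_append.1 hn).1
      refine (h3.and h4).imp_of_mem ?_
      intro b a hb ha hba
      have hbt : b ≠ t := by rintro rfl; grind
      have := (hm b).1 (List.mem_append_left _ hb)
      grind
    cases Q with
    | nil =>
      apply eq_range'_of_pairwise_lt
      · rw [List.pairwise_append]
        refine ⟨hinc, by simp, ?_⟩
        intro a ha b hb
        have := (hm a).1 (List.mem_append_left _ ha)
        grind
      · intro x; rw [hm]; omega
    | cons r Q =>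
      have hr : R t r := hsub _ _ (by rw [next_append]; simp [next_cons])
      have hzQ : z ∈ r :: Q := by
        rw [List.getLast?_append, List.getLast?_cons_cons] at hz
        refine List.mem_of_getLast? ?_
        cases h : (r :: Q).getLast? with
        | none => simp at h
        | some w => rw [h] at hz; simpa using hz
      have hzt : z < t := by
        have := (hm z).1 (by simp [hzQ])
        have : z ≠ t := by grind
        omega
      have hzu := (hm z).1 (by simp [hzQ])
      obtain ⟨y2, hy2, hy2'⟩ : ∃ y2, R y' y2 ∧ y' < y2 := by
        cases P with
        | nil => exact ⟨t, hsub _ _ (by simp [next_cons]), by omega⟩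
        | cons y2 P => exact ⟨y2, hsub _ _ (by simp [next_cons]), by grind⟩
      have hry : r < y' := by
        have : r ≠ y' := by grind
        have := hR h1 h2 hr (by omega) hzt (by omega)
        omega
      have hzy : z < y' := by
        have h3 := hw1 y' (by simp)
        have : z ≠ y' := by grind
        simp only [List.pairwise_cons] at h3
        rcases List.mem_cons.1 hzQ with rfl | hzQ
        · exact hry
        · have := h3.2.1 z hzQ hry
          omega
      exact absurd hy2' (hR h1 h2 hy2 (by omega) hzy (by omega))

theorem endsAtMin_range' (s m : ℕ) : EndsAtMin s (s + m + 2) (List.range' (s + 1) (m + 1)) := by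
  refine ⟨List.nodup_range', ?_, wordAvoids_of_pairwise_lt List.pairwise_lt_range', ?_⟩
  · intro x; simp; omega
  · have r : ∀ x y, Next ((s + m + 2) :: (List.range' (s + 1) (m + 1) ++ [s, s + m + 2])) x y ↔
        (x = s + m + 2 ∧ y = s + 1) ∨ (s + 1 ≤ x ∧ x ≤ s + m ∧ y = x + 1) ∨
        (x = s + m + 1 ∧ y = s) ∨ (x = s ∧ y = s + m + 2) := by
      intro x y
      rw [next_cons, next_append, next_range']
      simp [next_cons, List.getLast?_range', List.head?_range']
      omega
    unfold RelAvoids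
    simp only [r]
    intro i j k a b c
    omega

theorem startsAtMin_range' (s m : ℕ) :
    StartsAtMin s (s + m + 3) (List.range' (s + 2) (m + 1) ++ [s + 1]) := by
  refine ⟨?_, ?_, ?_, ?_⟩
  · rw [List.nodup_append]; simp [List.nodup_range']; omega
  · intro x; simp; omega
  · rw [wordAvoids_append]
    refine ⟨wordAvoids_of_pairwise_lt List.pairwise_lt_range', by simp [wordAvoids_cons],
      by simp, ?_⟩
    simp only [List.mem_singleton, forall_eq]
    refine List.pairwise_of_forall_mem_list ?_
    simp; omega
  · have r : ∀ x y, Next ((s + m + 3) :: s :: (List.range' (s + 2) (m + 1) ++ [s + 1] ++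
        [s + m + 3])) x y ↔
        (x = s + m + 3 ∧ y = s) ∨ (x = s ∧ y = s + 2) ∨
        (s + 2 ≤ x ∧ x ≤ s + m + 1 ∧ y = x + 1) ∨
        (x = s + m + 2 ∧ y = s + 1) ∨ (x = s + 1 ∧ y = s + m + 3) := by
      intro x y
      rw [List.append_assoc, next_cons, next_cons, next_append, next_range']
      simp [next_cons, List.getLast?_range', List.head?_range']
      omega
    unfold RelAvoids
    simp only [r]
    intro i j k a b c
    omega

/-- The set of words `A` with `EndsAtMin s (s + m + 1) A`. -/
def endsAtMinWords : ℕ → ℕ → Finset (List ℕ)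
  | 0, _ => {[]}
  | 1, s => {[s + 1]}
  | m + 2, s => (endsAtMinWords (m + 1) (s + 1)).image (· ++ [s + 1]) ∪
      ((endsAtMinWords m (s + 1)).image (fun Y => (s + 1) :: (s + m + 2) :: Y) ∪
        {List.range' (s + 1) (m + 2)})

/-- The set of words `B` with `StartsAtMin s (s + m + 1) B`. -/
def startsAtMinWords : ℕ → ℕ → Finset (List ℕ)
  | 0, _ => {[]}
  | 1, s => {[s + 1]}
  | m + 2, s => (startsAtMinWords (m + 1) (s + 1)).image ((s + 1) :: ·) ∪
      ((endsAtMinWords m (s + 1)).image (fun Y => (s + m + 2) :: (Y ++ [s + 1])) ∪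
        {List.range' (s + 2) (m + 1) ++ [s + 1]})

theorem exists_head?_getLast? {α : Type*} {l : List α} (h : l ≠ []) :
    ∃ y z, l.head? = some y ∧ l.getLast? = some z :=
  ⟨_, _, List.head?_eq_some_head h, List.getLast?_eq_some_getLast h⟩

theorem EndsAtMin.cases {s m : ℕ} {A : List ℕ} (h : EndsAtMin s (s + m + 3) A) :
    (∃ X, A = X ++ [s + 1]) ∨ (∃ Y, A = (s + 1) :: (s + m + 2) :: Y) ∨
      A = List.range' (s + 1) (m + 2) := by
  obtain ⟨h1, h2, h3, h4⟩ := h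
  obtain ⟨X, Y, rfl⟩ := List.append_of_mem ((h2 (s + 1)).2 ⟨by omega, by omega⟩)
  rcases eq_or_ne Y [] with rfl | hY
  · exact Or.inl ⟨X, rfl⟩
  obtain ⟨y, z, hy, hz⟩ := exists_head?_getLast? hY
  have hy' := List.mem_of_head? hy
  have hz' := List.mem_of_getLast? hz
  have hys := (h2 y).1 (by simp [hy'])
  have hzs := (h2 z).1 (by simp [hz'])
  have hys1 : y ≠ s + 1 := by grind
  have hzs1 : z ≠ s + 1 := by grind
  have hL : (s + m + 3) :: (X ++ (s + 1) :: Y ++ [s, s + m + 3]) =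
      ((s + m + 3) :: X) ++ ((s + 1) :: Y ++ [s, s + m + 3]) := by simp
  rw [hL] at h4
  have e1 : Next (((s + m + 3) :: X) ++ ((s + 1) :: Y ++ [s, s + m + 3])) (s + 1) y := by
    simp only [next_append (l := (s + m + 3) :: X), next_append (l := (s + 1) :: Y), next_cons]
    simp [hy]
  have e2 : Next (((s + m + 3) :: X) ++ ((s + 1) :: Y ++ [s, s + m + 3])) z s := by
    rw [next_append, next_append]; simp [List.getLast?_cons, hz]
  rcases eq_or_ne X [] with rfl | hX
  · right
    by_cases hyt : y = s + m + 2
    · left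
      subst hyt
      cases Y with
      | nil => simp at hy
      | cons a Y => exact ⟨Y, by simpa using hy⟩
    · right
      have := eq_range'_of_head_ne (u := s + 1) (t := s + m + 2) (U := Y) (by grind)
        (by intro x; have := h2 x; have := h2 (s + 1); grind) h3.2 h4 ?_ hy hz le_rfl (by omega)
          e1 e2 hyt
      · rw [this]; simp [List.range'_succ, show s + m + 2 - (s + 1) = m + 1 by omega]
      · intro a b hab
        simp only [next_append, next_cons]
        simp [hab]
  · exfalso
    obtain ⟨x, w, hx, hw⟩ := exists_head?_getLast? hX
    have hx' := List.mem_of_head? hx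
    have e3 : Next (((s + m + 3) :: X) ++ ((s + 1) :: Y ++ [s, s + m + 3])) (s + m + 3) x := by
      rw [next_append, next_cons]; simp [hx]
    have := h4 e1 e2 e3 (by omega) (by omega) (by omega)
    have hxs := (h2 x).1 (by simp [hx'])
    have h5 := (wordAvoids_append.1 h3).2.2.1 x hx'
    rw [List.pairwise_cons] at h5
    have := h5.1 y hy'
    grind

theorem mem_endsAtMinWords {m s : ℕ} {A : List ℕ} :
    A ∈ endsAtMinWords m s ↔ EndsAtMin s (s + m + 1) A := by
  induction m using Nat.strong_induction_on generalizing s A with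
  | _ m ih =>
  match m with
  | 0 =>
    simp only [endsAtMinWords, Finset.mem_singleton]
    constructor
    · rintro rfl
      refine ⟨by simp, by simp, trivial, ?_⟩
      intro i j k a b c
      simp [next_cons]
      omega
    · rintro ⟨-, h, -⟩
      rw [List.eq_nil_iff_forall_not_mem]
      intro x hx
      have := (h x).1 hx
      omega
  | 1 =>
    simp only [endsAtMinWords, Finset.mem_singleton]
    constructor
    · rintro rfl
      exact endsAtMin_range' s 0
    · rintro ⟨h1, h, -⟩
      have : A.Perm [s + 1] := by
        rw [List.perm_ext_iff_of_nodup h1 (by simp)]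
        intro x; rw [h]; simp; omega
      simpa using this
  | m + 2 =>
    have ih1 := @ih (m + 1) (by omega) (s + 1)
    have ih2 := @ih m (by omega) (s + 1)
    rw [show s + 1 + (m + 1) + 1 = s + m + 3 by omega] at ih1
    rw [show s + 1 + m + 1 = s + m + 2 by omega] at ih2
    rw [show s + (m + 2) + 1 = s + m + 3 by omega]
    have k1 := fun X => endsAtMin_append (s := s) (t := s + m + 3) (X := X) (by omega)
    have k2 := fun Y => endsAtMin_cons_cons (s := s) (t := s + m + 2) (Y := Y) (by omega)
    simp only [endsAtMinWords, Finset.mem_union, Finset.mem_image, Finset.mem_singleton, ih1, ih2]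
    constructor
    · rintro (⟨X, hX, rfl⟩ | ⟨Y, hY, rfl⟩ | rfl)
      · exact (k1 X).2 hX
      · exact (k2 Y).2 hY
      · exact endsAtMin_range' s (m + 1)
    · intro h
      rcases h.cases with ⟨X, rfl⟩ | ⟨Y, rfl⟩ | rfl
      · exact Or.inl ⟨X, (k1 X).1 h, rfl⟩
      · exact Or.inr (Or.inl ⟨Y, (k2 Y).1 h, rfl⟩)
      · simp

theorem StartsAtMin.cases {s m : ℕ} {B : List ℕ} (h : StartsAtMin s (s + m + 3) B) :
    (∃ Y, B = (s + 1) :: Y) ∨ (∃ Y, B = (s + m + 2) :: (Y ++ [s + 1])) ∨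
      B = List.range' (s + 2) (m + 1) ++ [s + 1] := by
  obtain ⟨h1, h2, h3, h4⟩ := h
  obtain ⟨X, Y, rfl⟩ := List.append_of_mem ((h2 (s + 1)).2 ⟨by omega, by omega⟩)
  rcases eq_or_ne X [] with rfl | hX
  · exact Or.inl ⟨Y, rfl⟩
  obtain ⟨x, w, hx, hw⟩ := exists_head?_getLast? hX
  have hx' := List.mem_of_head? hx
  have hxs := (h2 x).1 (by simp [hx'])
  have hxs1 : x ≠ s + 1 := by grind
  have hL : (s + m + 3) :: s :: (X ++ (s + 1) :: Y ++ [s + m + 3]) =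
      [s + m + 3, s] ++ (X ++ ((s + 1) :: Y ++ [s + m + 3])) := by simp
  rw [hL] at h4
  have e1 : Next ([s + m + 3, s] ++ (X ++ ((s + 1) :: Y ++ [s + m + 3]))) s x := by
    rw [next_append]; simp [hx]
  have e2 : Next ([s + m + 3, s] ++ (X ++ ((s + 1) :: Y ++ [s + m + 3]))) w (s + 1) := by
    rw [next_append, next_append]; simp [hw]
  rcases eq_or_ne Y [] with rfl | hY
  · right
    by_cases hxt : x = s + m + 2
    · left
      subst hxt
      cases X with
      | nil => simp at hx
      | cons a X => exact ⟨X, by simpa using hx⟩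
    · right
      have := eq_range'_of_head_ne (u := s + 1) (t := s + m + 2) (U := X) (by grind)
        (by intro x; have := h2 x; have := h2 (s + 1); grind) (wordAvoids_append.1 h3).1 h4 ?_ hx hw
          (by omega) le_rfl e1 e2 hxt
      · rw [this]; simp [show s + m + 2 - (s + 1) = m + 1 by omega]
      · intro a b hab
        rw [next_append, next_append]; simp [hab]
  · exfalso
    obtain ⟨y, z, hy, hz⟩ := exists_head?_getLast? hY
    have hy' := List.mem_of_head? hy
    have hz' := List.mem_of_getLast? hz
    have hys := (h2 y).1 (by simp [hy'])
    have hzs := (h2 z).1 (by simp [hz'])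
    have hys1 : y ≠ s + 1 := by grind
    have hzs1 : z ≠ s + 1 := by grind
    have e3 : Next ([s + m + 3, s] ++ (X ++ ((s + 1) :: Y ++ [s + m + 3]))) (s + 1) y := by
      simp only [next_append, next_cons]
      simp [hy]
    have e4 : Next ([s + m + 3, s] ++ (X ++ ((s + 1) :: Y ++ [s + m + 3]))) z (s + m + 3) := by
      rw [next_append, next_append, next_append]; simp [List.getLast?_cons, hz]
    have h5 := (wordAvoids_append.1 h3).2.2.1 x hx'
    rw [List.pairwise_cons] at h5
    have := h5.1 y hy'
    have := h4 e1 e3 e4 (by omega) (by omega)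
    grind

theorem mem_startsAtMinWords {m s : ℕ} {B : List ℕ} :
    B ∈ startsAtMinWords m s ↔ StartsAtMin s (s + m + 1) B := by
  induction m using Nat.strong_induction_on generalizing s B with
  | _ m ih =>
  match m with
  | 0 =>
    simp only [startsAtMinWords, Finset.mem_singleton]
    constructor
    · rintro rfl
      refine ⟨by simp, by simp, trivial, ?_⟩
      intro i j k a b c
      simp [next_cons]
      omega
    · rintro ⟨-, h, -⟩
      rw [List.eq_nil_iff_forall_not_mem]
      intro x hx
      have := (h x).1 hx
      omega
  | 1 =>
    simp only [startsAtMinWords, Finset.mem_singleton]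
    constructor
    · rintro rfl
      refine ⟨by simp, by simp; omega, by simp [wordAvoids_cons], ?_⟩
      intro i j k a b c
      simp [next_cons]
      omega
    · rintro ⟨h1, h, -⟩
      have : B.Perm [s + 1] := by
        rw [List.perm_ext_iff_of_nodup h1 (by simp)]
        intro x; rw [h]; simp; omega
      simpa using this
  | m + 2 =>
    have ih1 := @ih (m + 1) (by omega) (s + 1)
    have ih2 := @mem_endsAtMinWords m (s + 1)
    rw [show s + 1 + (m + 1) + 1 = s + m + 3 by omega] at ih1
    rw [show s + 1 + m + 1 = s + m + 2 by omega] at ih2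
    rw [show s + (m + 2) + 1 = s + m + 3 by omega]
    have k1 := fun Y => startsAtMin_cons (s := s) (t := s + m + 3) (Y := Y) (by omega)
    have k2 := fun Y => startsAtMin_cons_append (s := s) (t := s + m + 2) (Y := Y) (by omega)
    simp only [startsAtMinWords, Finset.mem_union, Finset.mem_image, Finset.mem_singleton, ih1, ih2]
    constructor
    · rintro (⟨Y, hY, rfl⟩ | ⟨Y, hY, rfl⟩ | rfl)
      · exact (k1 Y).2 hY
      · exact (k2 Y).2 hY
      · exact startsAtMin_range' s m
    · intro h
      rcases h.cases with ⟨Y, rfl⟩ | ⟨Y, rfl⟩ | rfl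
      · exact Or.inl ⟨Y, (k1 Y).1 h, rfl⟩
      · exact Or.inr (Or.inl ⟨Y, (k2 Y).1 h, rfl⟩)
      · simp

theorem card_endsAtMinWords (m s : ℕ) : (endsAtMinWords (m + 1) s).card + 1 = Nat.fib (m + 3) := by
  induction m using Nat.strong_induction_on generalizing s with
  | _ m ih =>
  match m with
  | 0 => simp [endsAtMinWords, Nat.fib_add_two]
  | 1 => simp [endsAtMinWords, Nat.fib_add_two, List.range'_succ]
  | m + 2 =>
    have ih1 := ih (m + 1) (by omega) (s + 1)
    have ih2 := ih m (by omega) (s + 1)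
    rw [endsAtMinWords, Finset.card_union_of_disjoint, Finset.card_union_of_disjoint,
      Finset.card_image_of_injective, Finset.card_image_of_injective, Finset.card_singleton,
      show m + 2 + 3 = m + 3 + 2 by omega]
    · have f := Nat.fib_add_two (n := m + 3)
      rw [show m + 1 + 3 = m + 3 + 1 by omega] at ih1
      omega
    · intro a b h; simpa using h
    · intro a b h; simpa using h
    · rw [Finset.disjoint_singleton_right]
      simp [List.range'_succ]
    · rw [Finset.disjoint_left]
      simp only [Finset.mem_image, Finset.mem_union, Finset.mem_singleton, mem_endsAtMinWords]
      rintro _ ⟨X, hX, rfl⟩ h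
      have h1 := hX.2.1 (s + 1)
      have h2 := hX.2.1 (s + 2)
      cases X with
      | nil => simp at h2; omega
      | cons x X => simp [List.range'_succ] at h1 h; omega

theorem card_startsAtMinWords (m s : ℕ) :
    (startsAtMinWords (m + 1) s).card + 1 = Nat.fib (m + 3) := by
  induction m using Nat.strong_induction_on generalizing s with
  | _ m ih =>
  match m with
  | 0 => simp [startsAtMinWords, Nat.fib_add_two]
  | 1 => simp [startsAtMinWords, endsAtMinWords, Nat.fib_add_two]
  | m + 2 =>
    have ih1 := ih (m + 1) (by omega) (s + 1)
    have ih2 := card_endsAtMinWords m (s + 1)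
    rw [startsAtMinWords, Finset.card_union_of_disjoint, Finset.card_union_of_disjoint,
      Finset.card_image_of_injective, Finset.card_image_of_injective, Finset.card_singleton,
      show m + 2 + 3 = m + 3 + 2 by omega]
    · have f := Nat.fib_add_two (n := m + 3)
      rw [show m + 1 + 3 = m + 3 + 1 by omega] at ih1
      omega
    · intro a b h; simpa using h
    · intro a b h; simpa using h
    · rw [Finset.disjoint_singleton_right]
      simp [List.range'_succ]
    · rw [Finset.disjoint_left]
      simp only [Finset.mem_image, Finset.mem_union, Finset.mem_singleton]
      rintro _ ⟨X, hX, rfl⟩ h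
      simp [List.range'_succ] at h
      obtain ⟨_, _, h, _⟩ := h
      omega

/-- The word `W` on `{0, …, t}` starts with `t`, and the permutation of `{0, …, t}` with the cycle
`W` and fixed points elsewhere, as well as its image under the fundamental bijection,
avoid `213`. -/
structure Good (t : ℕ) (W : List ℕ) : Prop where
  nodup : W.Nodup
  le : ∀ x ∈ W, x ≤ t
  head : W.head? = some t
  avoids : WordAvoids W
  fixed : ∀ f ≤ t, f ∉ W → W.Pairwise (fun a c => a < f → ¬ f < c)
  rel : RelAvoids (fun x y => Next (W ++ [t]) x y ∨ (x = y ∧ x ∉ W ∧ x ≤ t))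

theorem RelAvoids.mono {α : Type*} [LinearOrder α] {R S : α → α → Prop} (h : RelAvoids S)
    (hRS : ∀ x y, R x y → S x y) : RelAvoids R :=
  fun _ _ _ _ _ _ h1 h2 h3 => h (hRS _ _ h1) (hRS _ _ h2) (hRS _ _ h3)

theorem RelAvoids.or_eq {R D : ℕ → ℕ → Prop} {s : ℕ} (h : RelAvoids R)
    (hR : ∀ x y, R x y → s ≤ x ∧ s ≤ y) (hD : ∀ x y, D x y → x = y ∧ x < s) :
    RelAvoids (fun x y => R x y ∨ D x y) := by
  rintro i j k a b c h1 h2 h3 hij hjk hba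
  rcases h1 with h1 | h1
  · have := hR _ _ h1
    rcases h2 with h2 | h2
    · rcases h3 with h3 | h3
      · exact h h1 h2 h3 hij hjk hba
      · have := hD _ _ h3; omega
    · have := hD _ _ h2; omega
  · have := hD _ _ h1
    rcases h2 with h2 | h2
    · have := hR _ _ h2; omega
    · have := hD _ _ h2; omega

theorem wordAvoids_cons_of_le {t : ℕ} {R : List ℕ} (h : ∀ x ∈ R, x ≤ t) :
    WordAvoids (t :: R) ↔ WordAvoids R := by
  rw [wordAvoids_cons, and_iff_right]
  refine List.pairwise_of_forall_mem_list fun a ha c hc _ => ?_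
  exact (h c hc).not_gt

theorem wordAvoids_cons_of_ge {s : ℕ} {R : List ℕ} (h : ∀ x ∈ R, s ≤ x) :
    WordAvoids (s :: R) ↔ WordAvoids R := by
  rw [wordAvoids_cons, and_iff_right]
  refine List.pairwise_of_forall_mem_list fun a ha c hc h1 => ?_
  exact absurd h1 (h a ha).not_gt

theorem wordAvoids_concat_of_ge {s : ℕ} {R : List ℕ} (h : ∀ x ∈ R, s ≤ x) :
    WordAvoids (R ++ [s]) ↔ WordAvoids R := by
  rw [wordAvoids_append]
  refine ⟨And.left, fun h1 => ⟨h1, by simp [wordAvoids_cons], by simp, ?_⟩⟩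
  simp only [List.mem_singleton, forall_eq]
  refine List.pairwise_of_forall_mem_list fun a ha c hc _ => ?_
  exact (h a ha).not_gt

theorem good_of_interval {s t : ℕ} {W : List ℕ} (hn : W.Nodup) (hm : ∀ x, x ∈ W ↔ s ≤ x ∧ x ≤ t)
    (hh : W.head? = some t) (hw : WordAvoids W) (hR : RelAvoids (Next (W ++ [t]))) : Good t W := by
  refine ⟨hn, fun x hx => ((hm x).1 hx).2, hh, hw, ?_, ?_⟩
  · intro f hf hfW
    refine List.pairwise_of_forall_mem_list fun a ha c hc h1 => ?_
    have := (hm a).1 ha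
    have := hm f
    grind
  · refine hR.or_eq (s := s) (fun x y h => ?_) (fun x y h => ?_)
    · have h1 := (hm x).1 h.mem_of_concat
      have h2 := h.mem_right
      simp only [List.mem_append, hm, List.mem_singleton] at h2
      omega
    · have := hm x
      grind

theorem EndsAtMin.good {s t : ℕ} (hst : s < t) {A : List ℕ} (h : EndsAtMin s t A) :
    Good t (t :: (A ++ [s])) := by
  obtain ⟨h1, h2, h3, h4⟩ := h
  have hs := h2 s
  have ht := h2 t
  refine good_of_interval (s := s) (by grind) ?_ rfl ?_ (by simpa using h4)
  · intro x
    simp only [List.mem_cons, List.mem_append, h2, List.not_mem_nil, or_false]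
    omega
  · rw [wordAvoids_cons_of_le, wordAvoids_concat_of_ge]
    · exact h3
    · grind
    · grind

theorem StartsAtMin.good {s t : ℕ} (hst : s < t) {B : List ℕ} (h : StartsAtMin s t B) :
    Good t (t :: s :: B) := by
  obtain ⟨h1, h2, h3, h4⟩ := h
  have hs := h2 s
  have ht := h2 t
  refine good_of_interval (s := s) (by grind) ?_ rfl ?_ (by simpa using h4)
  · intro x
    simp only [List.mem_cons, h2]
    omega
  · rw [wordAvoids_cons_of_le, wordAvoids_cons_of_ge]
    · exact h3
    · grind
    · grind

theorem next_reverse {α : Type*} {l : List α} {x y : α} : Next l.reverse x y ↔ Next l y x := by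
  induction l with
  | nil => simp
  | cons a l ih =>
    rw [List.reverse_cons, next_append, next_cons, ih]
    simp [next_cons, eq_comm]
    tauto

theorem good_cons_range' {s t l : ℕ} (h : s + l + 1 < t) : Good t (t :: List.range' s (l + 1)) := by
  refine ⟨by simp [List.nodup_range']; omega, by simp; omega, rfl, ?_, ?_, ?_⟩
  · rw [wordAvoids_cons_of_le]
    · exact wordAvoids_of_pairwise_lt List.pairwise_lt_range'
    · simp; omega
  · intro f hf hfW
    simp only [List.mem_cons, List.mem_range'_1, not_or] at hfW
    refine List.pairwise_cons.2 ⟨by intros; omega, ?_⟩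
    refine List.pairwise_of_forall_mem_list fun a ha c hc h1 => ?_
    rw [List.mem_range'_1] at ha hc
    omega
  · have r : ∀ x y, (Next (t :: List.range' s (l + 1) ++ [t]) x y ∨
        (x = y ∧ x ∉ t :: List.range' s (l + 1) ∧ x ≤ t)) →
        (x = t ∧ y = s) ∨ (s ≤ x ∧ x < s + l ∧ y = x + 1) ∨ (x = s + l ∧ y = t) ∨
        (x = y ∧ x < s) ∨ (x = y ∧ s + l < x ∧ x < t) := by
      intro x y
      rw [List.cons_append, next_cons, next_append, next_range']
      simp [next_cons, List.getLast?_range', List.head?_range']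
      omega
    refine RelAvoids.mono ?_ r
    intro i j k a b c
    omega

theorem good_cons_reverse_range' {s t l : ℕ} (h : s + l + 1 < t) :
    Good t (t :: (List.range' s (l + 1)).reverse) := by
  refine ⟨by simp [List.nodup_range']; omega, by simp; omega, rfl, ?_, ?_, ?_⟩
  · rw [wordAvoids_cons_of_le]
    · exact wordAvoids_of_pairwise_gt (List.pairwise_reverse.2 List.pairwise_lt_range')
    · simp; omega
  · intro f hf hfW
    simp only [List.mem_cons, List.mem_reverse, List.mem_range'_1, not_or] at hfW
    refine List.pairwise_cons.2 ⟨by intros; omega, ?_⟩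
    refine List.pairwise_of_forall_mem_list fun a ha c hc h1 => ?_
    rw [List.mem_reverse, List.mem_range'_1] at ha hc
    omega
  · have r : ∀ x y, (Next (t :: (List.range' s (l + 1)).reverse ++ [t]) x y ∨
        (x = y ∧ x ∉ t :: (List.range' s (l + 1)).reverse ∧ x ≤ t)) →
        (x = t ∧ y = s + l) ∨ (s < x ∧ x ≤ s + l ∧ x = y + 1) ∨ (x = s ∧ y = t) ∨
        (x = y ∧ x < s) ∨ (x = y ∧ s + l < x ∧ x < t) := by
      intro x y
      rw [List.cons_append, next_cons, next_append, next_reverse, next_range']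
      simp [next_cons, List.getLast?_range', List.head?_range']
      omega
    refine RelAvoids.mono ?_ r
    intro i j k a b c
    omega

theorem exists_next_of_head?_getLast? {α : Type*} {l : List α} {P : α → Prop} {y z : α}
    (hy : l.head? = some y) (hz : l.getLast? = some z) (hPy : P y) (hPz : ¬ P z) :
    ∃ a b, Next l a b ∧ P a ∧ ¬ P b := by
  induction l generalizing y with
  | nil => simp at hy
  | cons a l ih =>
    obtain rfl : a = y := by simpa using hy
    cases l with
    | nil => simp at hz; grind
    | cons b l =>
      by_cases hb : P b
      · obtain ⟨c, d, h1, h2⟩ := ih (y := b) rfl (by simpa using hz) hb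
        exact ⟨c, d, next_cons.2 (Or.inr h1), h2⟩
      · exact ⟨a, b, by simp [next_cons], hPy, hb⟩

/-- A word whose successor relation is increasing is increasing or decreasing. -/
theorem pairwise_lt_or_gt_of_next {l : List ℕ} (hn : l.Nodup)
    (h : ∀ x y x' y', Next l x y → Next l x' y' → x < x' → ¬ y' < y) :
    l.Pairwise (· < ·) ∨ l.Pairwise (· > ·) := by
  induction l with
  | nil => simp
  | cons a l ih =>
    cases l with
    | nil => simp
    | cons b l =>
      cases l with
      | nil => simp; grind
      | cons c l =>
        have h1 := h a b b c (by simp [next_cons]) (by simp [next_cons])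
        have h2 := h b c a b (by simp [next_cons]) (by simp [next_cons])
        rcases ih hn.of_cons (fun x y x' y' hx hy => h x y x' y' (next_cons.2 (Or.inr hx))
          (next_cons.2 (Or.inr hy))) with h3 | h3
        · left
          have h3' := h3
          rw [List.pairwise_cons] at h3 ⊢
          refine ⟨?_, h3'⟩
          grind
        · right
          have h3' := h3
          rw [List.pairwise_cons] at h3 ⊢
          refine ⟨?_, h3'⟩
          grind

theorem Good.cyclic {s t : ℕ} (hst : s < t) {W : List ℕ} (h : Good t W)
    (hm : ∀ x, x ∈ W ↔ s ≤ x ∧ x ≤ t) :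
    (∃ A, W = t :: (A ++ [s]) ∧ EndsAtMin s t A) ∨ (∃ B, W = t :: s :: B ∧ StartsAtMin s t B) := by
  obtain ⟨h1, h2, h3, h4, -, h5⟩ := h
  have h5 : RelAvoids (Next (W ++ [t])) := h5.mono fun x y => Or.inl
  cases W with
  | nil => simp at h3
  | cons t' R =>
    obtain rfl : t' = t := by simpa using h3
    obtain ⟨P, Q, rfl⟩ := List.append_of_mem (a := s) (l := R) (by have := hm s; grind)
    have hw : WordAvoids (P ++ s :: Q) := h4.2
    have hQw := (wordAvoids_append.1 hw).2.1
    rcases eq_or_ne Q [] with rfl | hQ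
    · left
      refine ⟨P, rfl, by grind, ?_, (wordAvoids_append.1 hw).1, by simpa using h5⟩
      intro x
      have := hm x
      grind
    rcases eq_or_ne P [] with rfl | hP
    · right
      refine ⟨Q, rfl, by grind, ?_, hQw.2, by simpa using h5⟩
      intro x
      have := hm x
      grind
    exfalso
    obtain ⟨p, p', hp, hp'⟩ := exists_head?_getLast? hP
    obtain ⟨q, q', hq, hq'⟩ := exists_head?_getLast? hQ
    have m1 := List.mem_of_head? hp
    have m2 := List.mem_of_getLast? hp'
    have m3 := List.mem_of_head? hq
    have m4 := List.mem_of_getLast? hq'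
    have e1 : Next (t' :: (P ++ s :: Q) ++ [t']) t' p := by
      simp [next_cons, hp]
    have e2 : Next (t' :: (P ++ s :: Q) ++ [t']) s q := by
      simp only [List.cons_append, List.append_assoc, next_cons, next_append]
      simp [hq]
    have e3 : Next (t' :: (P ++ s :: Q) ++ [t']) p' s := by
      simp only [List.cons_append, List.append_assoc, next_cons, next_append]
      simp [hp']
    have h6 := (wordAvoids_append.1 hw).2.2.1 p m1
    rw [List.pairwise_cons] at h6
    have h7 := h6.1 q m3
    have h8 := h5 e2 e3 e1
    have r1 := hm p
    have r2 := hm p'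
    have r3 := hm q
    grind

theorem Good.noncyclic {s t f : ℕ} (hsf : s < f) (hft : f < t) {W : List ℕ} (h : Good t W)
    (hs : s ∈ W) (hmin : ∀ x ∈ W, s ≤ x) (hf : f ∉ W) :
    ∃ l, s + l + 1 < t ∧ (W = t :: List.range' s (l + 1) ∨
      W = t :: (List.range' s (l + 1)).reverse) := by
  obtain ⟨h1, h2, h3, h4, h5, h6⟩ := h
  cases W with
  | nil => simp at h3
  | cons t' R =>
    obtain rfl : t' = t := by simpa using h3
    have hsR : s ∈ R := by grind
    obtain ⟨y, z, hy, hz⟩ := exists_head?_getLast? (List.ne_nil_of_mem hsR)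
    have hyR := List.mem_of_head? hy
    have hzR := List.mem_of_getLast? hz
    have hnext : ∀ x y, Next R x y → Next (t' :: R ++ [t']) x y := by
      intro x y hxy
      simp [next_cons, next_append, hxy]
    have ety : Next (t' :: R ++ [t']) t' y := by simp [next_cons, hy]
    have h5f := (List.pairwise_cons.1 (h5 f hft.le hf)).2
    have hne : ∀ x ∈ R, x ≠ f ∧ x ≠ t' := by grind
    have hzf : z < f := by
      obtain ⟨P, Q, rfl⟩ := List.append_of_mem hsR
      have h7 := List.pairwise_cons.1 (List.pairwise_append.1 h5f).2.1
      have hz' : z = s ∨ z ∈ Q := by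
        cases Q with
        | nil => simp at hz; exact Or.inl hz.symm
        | cons q Q =>
          right
          rw [List.getLast?_append, List.getLast?_cons_cons] at hz
          refine List.mem_of_getLast? ?_
          cases h : (q :: Q).getLast? with
          | none => simp at h
          | some w => rw [h] at hz; simpa using hz
      have := h7.1 z
      have := hne z hzR
      grind
    have hyf : y < f := by
      by_contra hyf
      obtain ⟨a, b, hab, ha, hb⟩ := exists_next_of_head?_getLast? (P := fun x => f < x) hy hz
        (by have := hne y hyR; omega) (by omega)
      have haR := hab.mem_left
      have hbR := hab.mem_right
      have := h6 (Or.inr ⟨rfl, hf, hft.le⟩) (Or.inl (hnext _ _ hab)) (Or.inl ety) ha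
        (by grind) (by grind)
      have := hne y hyR
      omega
    have hlt : ∀ x ∈ R, x < f := by
      cases R with
      | nil => simp
      | cons r R =>
        obtain rfl : r = y := by simpa using hy
        intro x hx
        have := hne x hx
        rw [List.pairwise_cons] at h5f
        grind
    have hmono : ∀ x y x' y', (Next R x y ∨ (x = y ∧ x ∉ R ∧ x < f)) →
        (Next R x' y' ∨ (x' = y' ∧ x' ∉ R ∧ x' < f)) → x < x' → ¬ y' < y := by
      have aux : ∀ x y, (Next R x y ∨ (x = y ∧ x ∉ R ∧ x < f)) → x < f ∧ y < f ∧
          (Next (t' :: R ++ [t']) x y ∨ (x = y ∧ x ∉ t' :: R ∧ x ≤ t')) := by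
        rintro x y (h | ⟨rfl, h, h'⟩)
        · exact ⟨hlt _ h.mem_left, hlt _ h.mem_right, Or.inl (hnext _ _ h)⟩
        · exact ⟨h', h', Or.inr ⟨rfl, by grind, by omega⟩⟩
      intro x y x' y' hxy hxy' hx hyy
      have k1 := aux _ _ hxy
      have k2 := aux _ _ hxy'
      exact h6 k1.2.2 k2.2.2 (Or.inr ⟨rfl, hf, hft.le⟩) hx k2.1 hyy k1.2.1
    have hnR : R.Nodup := h1.of_cons
    rcases pairwise_lt_or_gt_of_next hnR (fun x y x' y' a b => hmono x y x' y' (.inl a) (.inl b))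
      with hp | hp
    · have hys : y = s := by
        cases R with
        | nil => simp at hy
        | cons r R =>
          obtain rfl : r = y := by simpa using hy
          have h7 := (List.pairwise_cons.1 hp).1
          have := hmin r (by simp)
          grind
      have hzmax : ∀ x ∈ R, x ≤ z := by
        obtain ⟨R', rfl⟩ := List.getLast?_eq_some_iff.1 hz
        grind
      refine ⟨z - s, by grind, Or.inl ?_⟩
      rw [List.cons.injEq, and_iff_right rfl]
      refine eq_range'_of_pairwise_lt hp fun x => ⟨fun hx => by grind, fun hx => ?_⟩
      by_contra hxR
      obtain ⟨a, b, hab, ha, hb⟩ := exists_next_of_head?_getLast? (P := fun u => u < x) hy hz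
        (by grind) (by grind)
      have := hmono a b x x (Or.inl hab) (Or.inr ⟨rfl, hxR, by grind⟩) ha
      have := hab.mem_right
      grind
    · have hzs : z = s := by
        obtain ⟨R', rfl⟩ := List.getLast?_eq_some_iff.1 hz
        grind
      have hymax : ∀ x ∈ R, x ≤ y := by
        cases R with
        | nil => simp
        | cons r R =>
          obtain rfl : r = y := by simpa using hy
          have h7 := (List.pairwise_cons.1 hp).1
          intro x hx
          rcases List.mem_cons.1 hx with rfl | hx
          · exact le_rfl
          · exact (h7 x hx).le
      have hyl := hlt y hyR
      have hsy := hymax s hsR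
      refine ⟨y - s, by omega, Or.inr ?_⟩
      rw [List.cons.injEq, and_iff_right rfl, ← List.reverse_eq_iff]
      refine eq_range'_of_pairwise_lt (List.pairwise_reverse.2 hp) fun x =>
        ⟨fun hx => ?_, fun hx => ?_⟩
      · rw [List.mem_reverse] at hx
        have := hymax x hx
        have := hmin x (by simp [hx])
        omega
      by_contra hxR
      rw [List.mem_reverse] at hxR
      have hxy : x ≠ y := by rintro rfl; exact hxR hyR
      obtain ⟨a, b, hab, ha, hb⟩ := exists_next_of_head?_getLast? (P := fun u => x < u) hy hz
        (by omega) (by omega)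
      have := hmono x x a b (Or.inr ⟨rfl, hxR, by omega⟩) (Or.inl hab) ha
      have := hab.mem_right
      grind

/-- The set of words `W ≠ [s + d + 1]` with `Good (s + d + 1) W` and minimum `s`. -/
def goodWordsWithMin (d s : ℕ) : Finset (List ℕ) :=
  ((endsAtMinWords d s).image (fun A => (s + d + 1) :: (A ++ [s])) ∪
    (startsAtMinWords d s).image (fun B => (s + d + 1) :: s :: B)) ∪
  ((Finset.range d).image (fun l => (s + d + 1) :: List.range' s (l + 1)) ∪
    (Finset.range (d - 1)).image (fun l => (s + d + 1) :: (List.range' s (l + 2)).reverse))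

theorem mem_goodWordsWithMin {d s : ℕ} {W : List ℕ} :
    W ∈ goodWordsWithMin d s ↔ Good (s + d + 1) W ∧ s ∈ W ∧ ∀ x ∈ W, s ≤ x := by
  simp only [goodWordsWithMin, Finset.mem_union, Finset.mem_image, mem_endsAtMinWords,
    mem_startsAtMinWords, Finset.mem_range]
  constructor
  · rintro ((⟨A, hA, rfl⟩ | ⟨B, hB, rfl⟩) | ⟨l, hl, rfl⟩ | ⟨l, hl, rfl⟩)
    · refine ⟨hA.good (by omega), by simp, ?_⟩
      have := hA.2.1
      grind
    · refine ⟨hB.good (by omega), by simp, ?_⟩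
      have := hB.2.1
      grind
    · refine ⟨good_cons_range' (by omega), by simp, ?_⟩
      simp only [List.mem_cons, List.mem_range'_1]; omega
    · refine ⟨good_cons_reverse_range' (by omega), by simp, ?_⟩
      simp only [List.mem_cons, List.mem_reverse, List.mem_range'_1]; omega
  · rintro ⟨h, hs, hmin⟩
    by_cases hm : ∀ x, s ≤ x → x ≤ s + d + 1 → x ∈ W
    · left
      rcases h.cyclic (s := s) (by omega) (fun x => ⟨fun hx => ⟨hmin x hx, h.le x hx⟩,
        fun hx => hm x hx.1 hx.2⟩) with ⟨A, rfl, hA⟩ | ⟨B, rfl, hB⟩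
      · exact Or.inl ⟨A, hA, rfl⟩
      · exact Or.inr ⟨B, hB, rfl⟩
    · right
      push Not at hm
      obtain ⟨f, h1, h2, hf⟩ := hm
      have hfs : f ≠ s := by rintro rfl; exact hf hs
      have hft : f ≠ s + d + 1 := by rintro rfl; exact hf (List.mem_of_head? h.head)
      obtain ⟨l, hl, rfl | rfl⟩ := h.noncyclic (f := f) (by omega) (by omega) hs hmin hf
      · exact Or.inl ⟨l, by omega, rfl⟩
      · cases l with
        | zero => exact Or.inl ⟨0, by omega, by simp⟩
        | succ l => exact Or.inr ⟨l, by omega, rfl⟩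

theorem card_goodWordsWithMin_zero (s : ℕ) : (goodWordsWithMin 0 s).card = 1 := by
  simp [goodWordsWithMin, endsAtMinWords, startsAtMinWords]

theorem card_goodWordsWithMin_succ (d s : ℕ) :
    (goodWordsWithMin (d + 1) s).card + 1 = 2 * Nat.fib (d + 3) + 2 * d := by
  have h1 := card_endsAtMinWords d s
  have h2 := card_startsAtMinWords d s
  rw [goodWordsWithMin, Finset.card_union_of_disjoint, Finset.card_union_of_disjoint,
    Finset.card_union_of_disjoint, Finset.card_image_of_injective, Finset.card_image_of_injective,
    Finset.card_image_of_injective, Finset.card_image_of_injective, Finset.card_range,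
    Finset.card_range]
  · omega
  · intro a b h
    have := congrArg List.length h
    simpa using this
  · intro a b h
    have := congrArg List.length h
    simpa using this
  · intro a b h
    simpa using h
  · intro a b h
    simpa using h
  · rw [Finset.disjoint_left]
    simp only [Finset.mem_image, not_exists, not_and]
    rintro _ ⟨l, -, rfl⟩ l' - h
    rw [List.cons.injEq] at h
    have := congrArg List.head? h.2
    simp [List.getLast?_range', List.head?_range'] at this
  · rw [Finset.disjoint_left]
    simp only [Finset.mem_image, mem_endsAtMinWords, mem_startsAtMinWords, not_exists, not_and]
    rintro _ ⟨A, hA, rfl⟩ B hB h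
    have h3 := (hA.2.1 (s + 1)).2 (by omega)
    have h4 := (hA.2.1 s)
    rw [List.cons.injEq] at h
    cases A with
    | nil => simp at h3
    | cons a A =>
      have := h.2
      simp at this h4
      omega
  · rw [Finset.disjoint_left]
    have key : ∀ W, (W ∈ (endsAtMinWords (d + 1) s).image (fun A => (s + (d + 1) + 1) :: (A ++ [s])) ∪
        (startsAtMinWords (d + 1) s).image (fun B => (s + (d + 1) + 1) :: s :: B)) →
        s + (d + 1) ∈ W := by
      intro W
      simp only [Finset.mem_union, Finset.mem_image, mem_endsAtMinWords, mem_startsAtMinWords]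
      rintro (⟨A, hA, rfl⟩ | ⟨B, hB, rfl⟩)
      · simp [(hA.2.1 (s + (d + 1))).2 (by omega)]
      · simp [(hB.2.1 (s + (d + 1))).2 (by omega)]
    intro W hW hW'
    have := key W hW
    simp only [Finset.mem_union, Finset.mem_image, Finset.mem_range] at hW'
    rcases hW' with ⟨l, hl, rfl⟩ | ⟨l, hl, rfl⟩ <;> simp at this <;> omega

/-- The set of words `W` with `Good t W`. -/
def goodWords (t : ℕ) : Finset (List ℕ) :=
  insert [t] ((Finset.range t).biUnion fun d => goodWordsWithMin d (t - 1 - d))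

theorem good_singleton (t : ℕ) : Good t [t] := by
  refine ⟨by simp, by simp, rfl, by simp [wordAvoids_cons], by simp, ?_⟩
  intro i j k a b c
  simp [next_cons]
  omega

theorem mem_goodWords {t : ℕ} {W : List ℕ} : W ∈ goodWords t ↔ Good t W := by
  simp only [goodWords, Finset.mem_insert, Finset.mem_biUnion, Finset.mem_range,
    mem_goodWordsWithMin]
  constructor
  · rintro (rfl | ⟨d, hd, h, -⟩)
    · exact good_singleton t
    · rwa [show t - 1 - d + d + 1 = t by omega] at h
  · intro h
    have ht := List.mem_of_head? h.head
    obtain ⟨s, hs, hmin⟩ := W.toFinset.exists_min_image id ⟨t, by simpa using ht⟩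
    simp only [List.mem_toFinset, id] at hs hmin
    rcases eq_or_ne s t with rfl | hst
    · left
      have hall : ∀ x ∈ W, x = s := fun x hx => le_antisymm (h.le x hx) (hmin x hx)
      have : W.Perm [s] := by
        rw [List.perm_ext_iff_of_nodup h.nodup (by simp)]
        grind
      simpa using this
    · right
      have := h.le s hs
      refine ⟨t - 1 - s, by omega, ?_⟩
      rw [show t - 1 - (t - 1 - s) = s by omega, show s + (t - 1 - s) + 1 = t by omega]
      exact ⟨h, hs, hmin⟩

theorem card_goodWords_eq_sum (t : ℕ) :
    (goodWords t).card = ∑ d ∈ Finset.range t, (goodWordsWithMin d (t - 1 - d)).card + 1 := by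
  rw [goodWords, Finset.card_insert_of_notMem, Finset.card_biUnion]
  · intro d hd d' hd' hne
    rw [Finset.coe_range, Set.mem_Iio] at hd hd'
    refine Finset.disjoint_left.2 fun W hW hW' => ?_
    rw [mem_goodWordsWithMin] at hW hW'
    have h1 := hW.2.2 _ hW'.2.1
    have h2 := hW'.2.2 _ hW.2.1
    omega
  · simp only [Finset.mem_biUnion, Finset.mem_range, mem_goodWordsWithMin, not_exists, not_and]
    intro d hd _ h
    simp at h
    omega

theorem card_goodWords (t : ℕ) : ((goodWords (t + 1)).card : ℤ) =
    2 * Nat.fib (t + 4) + (t + 2 : ℤ) ^ 2 - 6 * (t + 2 : ℤ) + 4 := by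
  have h : ∀ d s, ((goodWordsWithMin (d + 1) s).card : ℤ) = 2 * Nat.fib (d + 3) + 2 * d - 1 := by
    intro d s
    have := card_goodWordsWithMin_succ d s
    omega
  rw [card_goodWords_eq_sum, Finset.sum_range_succ', card_goodWordsWithMin_zero]
  push_cast
  simp only [h]
  induction t with
  | zero => norm_num [Nat.fib_add_two]
  | succ t ih =>
    rw [Finset.sum_range_succ, show t + 1 + 4 = t + 3 + 2 by omega, Nat.fib_add_two (n := t + 3)]
    push_cast at ih ⊢
    linarith

theorem wordAvoids_iff_sublist {α : Type*} [LinearOrder α] {l : List α} :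
    WordAvoids l ↔ ∀ b a c, [b, a, c].Sublist l → a < b → ¬ b < c := by
  induction l with
  | nil => simp
  | cons x l ih =>
    rw [wordAvoids_cons, ih, List.pairwise_iff_forall_sublist]
    simp only [List.sublist_cons_iff (l := [_, _, _]), List.cons.injEq]
    constructor
    · rintro ⟨h1, h2⟩ b a c (h | ⟨r, ⟨rfl, rfl⟩, h⟩)
      · exact h2 b a c h
      · exact h1 h
    · intro h
      exact ⟨fun {a c} hac => h x a c (Or.inr ⟨_, ⟨rfl, rfl⟩, hac⟩),
        fun b a c hbac => h b a c (Or.inl hbac)⟩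

theorem WordAvoids.sublist {α : Type*} [LinearOrder α] {l r : List α} (h : WordAvoids r)
    (hl : l.Sublist r) : WordAvoids l := by
  rw [wordAvoids_iff_sublist] at h ⊢
  exact fun b a c hbac => h b a c (hbac.trans hl)

theorem wordAvoids_map {α β : Type*} [LinearOrder α] [LinearOrder β] {f : α → β}
    (hf : StrictMono f) {l : List α} : WordAvoids (l.map f) ↔ WordAvoids l := by
  induction l with
  | nil => simp
  | cons x l ih => simp only [List.map_cons, wordAvoids_cons, ih, List.pairwise_map, hf.lt_iff_lt]

theorem avoids_p213_iff {n : ℕ} {σ : Equiv.Perm (Fin n)} :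
    Avoids σ p213 ↔ RelAvoids (fun x y => σ x = y) := by
  have h0 : p213 0 = 1 := rfl
  have h1 : p213 1 = 0 := rfl
  have h2 : p213 2 = 2 := rfl
  constructor
  · rintro h i j k _ _ _ rfl rfl rfl hij hjk hba hac
    refine h ⟨![i, j, k], ?_, ?_⟩
    · intro a b hab
      fin_cases a <;> fin_cases b <;> simp at hab ⊢ <;> grind
    · intro a b
      fin_cases a <;> fin_cases b <;> simp [h0, h1, h2] <;> grind
  · rintro h ⟨f, hf, hσ⟩
    refine h rfl rfl rfl (hf (show (0 : Fin 3) < 1 by decide)) (hf (show (1 : Fin 3) < 2 by decide))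
      ((hσ 1 0).2 (by rw [h0, h1]; decide)) ((hσ 0 2).2 (by rw [h0, h2]; decide))

theorem relAvoids_iff_wordAvoids {n : ℕ} {σ : Equiv.Perm (Fin n)} :
    RelAvoids (fun x y => σ x = y) ↔ WordAvoids ((List.finRange n).map σ) := by
  rw [wordAvoids_iff_sublist]
  constructor
  · intro h b a c hbac
    obtain ⟨l, hl, hl'⟩ := List.sublist_map_iff.1 hbac
    match l, hl' with
    | [i, j, k], hl' =>
      have hp := (List.pairwise_lt_finRange n).sublist hl
      simp at hp hl'
      exact h hl'.1.symm hl'.2.1.symm hl'.2.2.symm hp.1.1 hp.2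
  · rintro h i j k _ _ _ rfl rfl rfl hij hjk
    refine h _ _ _ (List.Sublist.map σ (l₁ := [i, j, k]) ?_)
    refine List.sublist_of_subperm_of_pairwise (r := (· ≤ ·)) ?_ ?_ ?_
    · refine List.subperm_of_subset ?_ ?_
      · simp; grind
      · intro x _; exact List.mem_finRange x
    · simp; grind
    · exact (List.pairwise_lt_finRange n).imp le_of_lt

/-- The cycle of `x` as a word starting with `x`. -/
noncomputable def orbitWord {n : ℕ} (π : Equiv.Perm (Fin n)) (x : Fin n) : List (Fin n) :=
  (List.range (Function.minimalPeriod (⇑π) x)).map fun k => (⇑π)^[k] x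

section orbitWord
variable {n : ℕ} {π : Equiv.Perm (Fin n)} {x y z : Fin n}

theorem minimalPeriod_pos (π : Equiv.Perm (Fin n)) (x : Fin n) :
    0 < Function.minimalPeriod π x :=
  Function.minimalPeriod_pos_of_mem_periodicPts (π.injective.mem_periodicPts x)

theorem iterate_mem_orbitWord (k : ℕ) : (⇑π)^[k] x ∈ orbitWord π x := by
  rw [← Function.iterate_mod_minimalPeriod_eq]
  exact List.mem_map_of_mem (f := fun k => (⇑π)^[k] x)
    (List.mem_range.2 (Nat.mod_lt _ (minimalPeriod_pos π x)))

theorem mem_orbitWord : y ∈ orbitWord π x ↔ π.SameCycle x y := by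
  constructor
  · intro h
    obtain ⟨k, -, rfl⟩ := List.mem_map.1 h
    exact ⟨k, by rw [π.iterate_eq_pow]; simp⟩
  · intro h
    obtain ⟨k, rfl⟩ := h.exists_nat_pow_eq
    rw [← π.iterate_eq_pow]
    exact iterate_mem_orbitWord k

theorem nodup_orbitWord : (orbitWord π x).Nodup := by
  refine List.Nodup.map_on ?_ List.nodup_range
  intro a ha b hb hab
  exact Function.iterate_injOn_Iio_minimalPeriod (List.mem_range.1 ha) (List.mem_range.1 hb) hab

theorem head?_orbitWord : (orbitWord π x).head? = some x := by
  have := minimalPeriod_pos π x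
  obtain ⟨m, hm⟩ := Nat.exists_eq_add_one_of_ne_zero this.ne'
  simp [orbitWord, hm, List.range_succ_eq_map]

theorem orbitWord_eq_singleton (h : π x = x) : orbitWord π x = [x] := by
  rw [orbitWord, Function.minimalPeriod_eq_one_iff_isFixedPt.2 h]
  simp

theorem sublist_orbitWord (h : π x ≠ x) : [x, π x].Sublist (orbitWord π x) := by
  have h1 := minimalPeriod_pos π x
  have h2 : Function.minimalPeriod π x ≠ 1 := by
    rwa [Ne, Function.minimalPeriod_eq_one_iff_isFixedPt]
  exact List.Sublist.map (fun k => (⇑π)^[k] x) (List.range_sublist.2 (show 2 ≤ _ by omega))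

theorem next_orbitWord : Next (orbitWord π x ++ [x]) y z ↔ π.SameCycle x y ∧ π y = z := by
  have key : ∀ m (g : ℕ → Fin n), Next ((List.range (m + 1)).map g) y z ↔
      ∃ k < m, y = g k ∧ z = g (k + 1) := by
    intro m g
    induction m with
    | zero => simp [next_cons]
    | succ m ih =>
      rw [List.range_succ, List.map_append, next_append, ih]
      simp only [List.getLast?_map, List.getLast?_range, List.map_cons, List.map_nil, next_cons]
      simp only [Nat.lt_succ_iff_lt_or_eq]
      simp
      grind
  have h : orbitWord π x ++ [x] = (List.range (Function.minimalPeriod π x + 1)).map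
      fun k => (⇑π)^[k] x := by
    rw [List.range_succ, List.map_append, orbitWord]
    simp [Function.iterate_minimalPeriod]
  rw [h, key, ← mem_orbitWord, orbitWord]
  simp only [List.mem_map, List.mem_range, Function.iterate_succ_apply']
  constructor
  · rintro ⟨k, hk, rfl, rfl⟩
    exact ⟨⟨k, hk, rfl⟩, rfl⟩
  · rintro ⟨⟨k, hk, rfl⟩, rfl⟩
    exact ⟨k, hk, rfl, rfl⟩

end orbitWord

section fundWord
variable {n : ℕ} {π : Equiv.Perm (Fin n)} {x : Fin n}

theorem isMax_iff : ((List.range n).all fun k => decide ((⇑π)^[k] x ≤ x)) = true ↔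
    ∀ y, π.SameCycle x y → y ≤ x := by
  simp only [List.all_eq_true, List.mem_range, decide_eq_true_eq]
  constructor
  · intro h y hy
    obtain ⟨k, hk, rfl⟩ := List.mem_map.1 (mem_orbitWord.2 hy)
    have := Function.minimalPeriod_le_card (f := π) (x := x)
    rw [Fintype.card_fin] at this
    exact h k ((List.mem_range.1 hk).trans_le this)
  · exact fun h k _ => h _ (mem_orbitWord.1 (iterate_mem_orbitWord k))

theorem exists_isMax (π : Equiv.Perm (Fin n)) (x : Fin n) :
    ∃ M, π.SameCycle M x ∧ ∀ y, π.SameCycle M y → y ≤ M := by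
  classical
  obtain ⟨M, hM, hmax⟩ := (orbitWord π x).toFinset.exists_max_image id
    ⟨x, by simp [mem_orbitWord, Equiv.Perm.SameCycle.refl]⟩
  simp only [List.mem_toFinset, mem_orbitWord, id] at hM hmax
  exact ⟨M, hM.symm, fun y hy => hmax y (hM.trans hy)⟩

theorem fundWord_eq : fundWord π = ((List.finRange n).filter fun x => (List.range n).all fun k =>
    decide ((⇑π)^[k] x ≤ x)).flatMap (orbitWord π) := rfl

theorem mem_fundWord : x ∈ fundWord π := by
  obtain ⟨M, hM, hmax⟩ := exists_isMax π x
  rw [fundWord_eq, List.mem_flatMap]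
  exact ⟨M, List.mem_filter.2 ⟨List.mem_finRange M, isMax_iff.2 hmax⟩, mem_orbitWord.2 hM⟩

theorem nodup_fundWord : (fundWord π).Nodup := by
  rw [fundWord_eq, List.nodup_flatMap]
  refine ⟨fun x _ => nodup_orbitWord, ?_⟩
  refine ((List.nodup_finRange n).filter _).imp_of_mem ?_
  intro a b ha hb hab x hxa hxb
  rw [mem_orbitWord] at hxa hxb
  have ha' := isMax_iff.1 (List.mem_filter.1 ha).2
  have hb' := isMax_iff.1 (List.mem_filter.1 hb).2
  exact hab (le_antisymm (hb' a (hxb.trans hxa.symm)) (ha' b (hxa.trans hxb.symm)))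

theorem map_theta : (List.finRange n).map (theta π) = fundWord π := by
  have hl : (fundWord π).length = n := by
    have : (fundWord π).Perm (List.finRange n) := by
      rw [List.perm_ext_iff_of_nodup nodup_fundWord (List.nodup_finRange n)]
      simp [mem_fundWord]
    simpa using this.length_eq
  have hinj : Function.Injective fun i : Fin n => (fundWord π)[i.val]'(by omega) := by
    intro i j hij
    exact Fin.ext ((List.Nodup.getElem_inj_iff nodup_fundWord).1 hij)
  refine Function.invFun_eq (f := fun σ : Equiv.Perm (Fin n) => (List.finRange n).map ⇑σ)
    ⟨Equiv.ofBijective _ (Finite.injective_iff_bijective.1 hinj), ?_⟩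
  refine List.ext_getElem (by simp [hl]) ?_
  intro i h1 h2
  simp

theorem avoids_theta_iff : Avoids (theta π) p213 ↔ WordAvoids (fundWord π) := by
  rw [avoids_p213_iff, relAvoids_iff_wordAvoids, map_theta]

end fundWord

section lastCycle
variable {t : ℕ} {π : Equiv.Perm (Fin (t + 1))}

theorem isMax_last_of_mem {x : Fin (t + 1)} (hx : x ∈ orbitWord π (Fin.last t))
    (hmax : ∀ y, π.SameCycle x y → y ≤ x) : x = Fin.last t :=
  le_antisymm (Fin.le_last x) (hmax _ (mem_orbitWord.1 hx).symm)

theorem fundWord_succ : fundWord π = (((List.finRange t).map Fin.castSucc).filter fun x =>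
    (List.range (t + 1)).all fun k => decide ((⇑π)^[k] x ≤ x)).flatMap (orbitWord π) ++
      orbitWord π (Fin.last t) := by
  have h : ((List.range (t + 1)).all fun k => decide ((⇑π)^[k] (Fin.last t) ≤ Fin.last t)) = true :=
    isMax_iff.2 fun y _ => Fin.le_last y
  rw [fundWord_eq, List.finRange_succ_last, List.filter_append, List.flatMap_append,
    List.filter_cons, if_pos h, List.filter_nil, List.flatMap_singleton]

theorem apply_eq_of_wordAvoids_fundWord (h : WordAvoids (fundWord π)) {x : Fin (t + 1)}
    (hx : x ∉ orbitWord π (Fin.last t)) : π x = x := by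
  by_contra hne
  obtain ⟨M, hM, hmax⟩ := exists_isMax π x
  have hML : M ≠ Fin.last t := by
    rintro rfl
    exact hx (mem_orbitWord.2 hM)
  have hMM : π M ≠ M := by
    intro h'
    have : x ∈ orbitWord π M := mem_orbitWord.2 hM
    rw [orbitWord_eq_singleton h', List.mem_singleton] at this
    exact hne (this ▸ h')
  rw [fundWord_succ] at h
  have h1 : [M, π M, Fin.last t].Sublist (((((List.finRange t).map Fin.castSucc).filter fun x =>
      (List.range (t + 1)).all fun k => decide ((⇑π)^[k] x ≤ x)).flatMap (orbitWord π)) ++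
        orbitWord π (Fin.last t)) := by
    refine List.Sublist.append (l₁ := [M, π M]) (r₁ := [Fin.last t]) ?_ ?_
    · refine (sublist_orbitWord hMM).trans (List.sublist_flatten_of_mem ?_)
      refine List.mem_map_of_mem (List.mem_filter.2 ⟨?_, isMax_iff.2 hmax⟩)
      have := List.mem_finRange M
      rw [List.finRange_succ_last] at this
      simpa [hML] using this
    · simpa using List.mem_of_head? (head?_orbitWord (π := π) (x := Fin.last t))
  refine wordAvoids_iff_sublist.1 h _ _ _ h1 ?_ (Fin.lt_last_iff_ne_last.2 hML)
  exact lt_of_le_of_ne (hmax _ ⟨1, by simp⟩) hMM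

theorem fundWord_eq_of_fixed (h : ∀ x, x ∉ orbitWord π (Fin.last t) → π x = x) :
    fundWord π = (List.finRange (t + 1)).filter (fun x => x ∉ orbitWord π (Fin.last t)) ++
      orbitWord π (Fin.last t) := by
  have hl := List.mem_of_head? (head?_orbitWord (π := π) (x := Fin.last t))
  rw [fundWord_succ, List.finRange_succ_last, List.filter_append,
    List.filter_cons_of_neg (by simpa using hl), List.filter_nil, List.append_nil]
  congr 1
  have hp : ∀ x ∈ (List.finRange t).map Fin.castSucc,
      ((List.range (t + 1)).all fun k => decide ((⇑π)^[k] x ≤ x)) =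
        decide (x ∉ orbitWord π (Fin.last t)) := by
    intro x hx
    rw [Bool.eq_iff_iff, isMax_iff, decide_eq_true_eq]
    constructor
    · intro hmax hxl
      rw [isMax_last_of_mem hxl hmax] at hx
      simp at hx
    · intro hxl y hy
      rw [← mem_orbitWord, orbitWord_eq_singleton (h x hxl), List.mem_singleton] at hy
      exact hy.le
  rw [List.filter_congr hp]
  refine (List.flatMap_congr fun x hx => ?_).trans (List.flatMap_singleton' _)
  exact orbitWord_eq_singleton (h x (by simpa using (List.mem_filter.1 hx).2))

theorem next_map {α β : Type*} {f : α → β} {l : List α} {x y : β} :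
    Next (l.map f) x y ↔ ∃ a b, Next l a b ∧ f a = x ∧ f b = y := by
  induction l with
  | nil => simp
  | cons c l ih =>
    rw [List.map_cons, next_cons, ih]
    simp only [next_cons, List.head?_map, Option.map_eq_some_iff]
    grind

theorem rel_map_orbitWord (h : ∀ x, x ∉ orbitWord π (Fin.last t) → π x = x) (x y : ℕ) :
    (Next ((orbitWord π (Fin.last t)).map Fin.val ++ [t]) x y ∨
      (x = y ∧ x ∉ (orbitWord π (Fin.last t)).map Fin.val ∧ x ≤ t)) ↔
    ∃ a b : Fin (t + 1), π a = b ∧ a.val = x ∧ b.val = y := by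
  have e : (orbitWord π (Fin.last t)).map Fin.val ++ [t] =
      (orbitWord π (Fin.last t) ++ [Fin.last t]).map Fin.val := by simp
  rw [e, next_map]
  simp only [next_orbitWord, ← mem_orbitWord]
  constructor
  · rintro (⟨a, b, ⟨-, h2⟩, h3⟩ | ⟨rfl, h2, h3⟩)
    · exact ⟨a, b, h2, h3⟩
    · refine ⟨⟨x, by omega⟩, ⟨x, by omega⟩, h _ fun h' => h2 ?_, rfl, rfl⟩
      exact List.mem_map_of_mem (f := Fin.val) h'
  · rintro ⟨a, b, rfl, rfl, rfl⟩
    by_cases ha : a ∈ orbitWord π (Fin.last t)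
    · exact Or.inl ⟨a, π a, ⟨ha, rfl⟩, rfl, rfl⟩
    · refine Or.inr ⟨by rw [h a ha], ?_, by omega⟩
      simpa [Fin.val_inj] using ha

theorem relAvoids_map_orbitWord (h : ∀ x, x ∉ orbitWord π (Fin.last t) → π x = x) :
    RelAvoids (fun x y => Next ((orbitWord π (Fin.last t)).map Fin.val ++ [t]) x y ∨
      (x = y ∧ x ∉ (orbitWord π (Fin.last t)).map Fin.val ∧ x ≤ t)) ↔
    RelAvoids (fun x y => π x = y) := by
  simp only [rel_map_orbitWord h]
  constructor
  · intro h i j k a b c h1 h2 h3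
    exact h ⟨i, a, h1, rfl, rfl⟩ ⟨j, b, h2, rfl, rfl⟩ ⟨k, c, h3, rfl, rfl⟩
  · rintro h _ _ _ _ _ _ ⟨i, a, h1, rfl, rfl⟩ ⟨j, b, h2, rfl, rfl⟩ ⟨k, c, h3, rfl, rfl⟩
    exact h h1 h2 h3

theorem avoids_and_avoids_theta_iff : Avoids π p213 ∧ Avoids (theta π) p213 ↔
    (∀ x, x ∉ orbitWord π (Fin.last t) → π x = x) ∧
      Good t ((orbitWord π (Fin.last t)).map Fin.val) := by
  rw [avoids_theta_iff, avoids_p213_iff]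
  have hsort : ∀ p : Fin (t + 1) → Bool, ((List.finRange (t + 1)).filter p).Pairwise (· < ·) :=
    fun p => (List.pairwise_lt_finRange _).filter p
  constructor
  · rintro ⟨h1, h2⟩
    have hfix := fun x => apply_eq_of_wordAvoids_fundWord h2 (x := x)
    rw [fundWord_eq_of_fixed hfix, wordAvoids_append] at h2
    refine ⟨hfix, nodup_orbitWord.map Fin.val_injective, by simp; omega, ?_,
      (wordAvoids_map Fin.val_strictMono).2 h2.2.1, ?_, (relAvoids_map_orbitWord hfix).2 h1⟩
    · rw [List.head?_map, head?_orbitWord]; rfl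
    · intro f hf hfW
      rw [List.pairwise_map]
      exact h2.2.2.1 ⟨f, by omega⟩ (List.mem_filter.2 ⟨List.mem_finRange _, by
        simpa using fun h' => hfW (List.mem_map_of_mem (f := Fin.val) h')⟩)
  · rintro ⟨hfix, hg⟩
    refine ⟨(relAvoids_map_orbitWord hfix).1 hg.rel, ?_⟩
    rw [fundWord_eq_of_fixed hfix, wordAvoids_append]
    refine ⟨wordAvoids_of_pairwise_lt (hsort _), (wordAvoids_map Fin.val_strictMono).1 hg.avoids,
      ?_, ?_⟩
    · intro b hb
      have := hg.fixed b (by omega) (by simpa [Fin.val_inj] using hb)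
      rwa [List.pairwise_map] at this
    · intro c _
      exact (hsort _).imp fun h1 h2 => absurd h2 h1.not_gt

theorem orbitWord_formPerm {n : ℕ} {x : Fin n} {l : List (Fin n)} (hl : (x :: l).Nodup) :
    orbitWord (x :: l).formPerm x = x :: l := by
  have h := List.formPerm_pow_apply_head x l hl
  have hp : Function.minimalPeriod (x :: l).formPerm x = (x :: l).length := by
    refine Nat.dvd_antisymm ?_ ?_
    · refine Function.IsPeriodicPt.minimalPeriod_dvd ?_
      rw [Function.IsPeriodicPt, Function.IsFixedPt, Equiv.Perm.iterate_eq_pow, h]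
      simp
    · have h1 := Function.iterate_minimalPeriod (f := (x :: l).formPerm) (x := x)
      rw [Equiv.Perm.iterate_eq_pow, h] at h1
      exact Nat.dvd_of_mod_eq_zero ((hl.getElem_inj_iff (hj := by simp)).1 h1)
  refine List.ext_getElem (by simp [orbitWord, hp]) ?_
  intro i h1 h2
  simp only [orbitWord, List.getElem_map, List.getElem_range]
  rw [Equiv.Perm.iterate_eq_pow, h]
  simp only [Nat.mod_eq_of_lt h2]

theorem card_avoids (t : ℕ) : Nat.card {π : Equiv.Perm (Fin (t + 1)) //
    Avoids π p213 ∧ Avoids (theta π) p213} = (goodWords t).card := by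
  simp only [avoids_and_avoids_theta_iff]
  refine (Nat.card_congr (Equiv.ofBijective (β := goodWords t)
    (fun π => ⟨_, mem_goodWords.2 π.2.2⟩) ⟨?_, ?_⟩)).trans
      (Nat.card_eq_fintype_card.trans (Fintype.card_coe _))
  · rintro ⟨π, hπ, _⟩ ⟨σ, hσ, _⟩ h
    replace h := List.map_injective_iff.2 Fin.val_injective (congrArg Subtype.val h)
    refine Subtype.ext (Equiv.ext fun x => ?_)
    by_cases hx : x ∈ orbitWord π (Fin.last t)
    · have h1 := (next_orbitWord (π := π) (x := Fin.last t)).2 ⟨mem_orbitWord.1 hx, rfl⟩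
      rw [h] at h1
      exact (next_orbitWord.1 h1).2.symm
    · have hx' := hx
      rw [h] at hx'
      rw [hπ x hx, hσ x hx']
  · rintro ⟨W, hW⟩
    rw [mem_goodWords] at hW
    obtain ⟨l, rfl⟩ : ∃ l : List (Fin (t + 1)), l.map Fin.val = W := by
      refine ⟨W.attach.map fun x => ⟨x.1, Nat.lt_succ_of_le (hW.le x.1 x.2)⟩, ?_⟩
      simp [List.map_map, Function.comp_def]
    cases l with
    | nil => simpa using hW.head
    | cons x l =>
      obtain rfl : x = Fin.last t := Fin.ext (by simpa using hW.head)
      have hl : (Fin.last t :: l).Nodup := hW.nodup.of_map _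
      have ho := orbitWord_formPerm hl
      refine ⟨⟨(Fin.last t :: l).formPerm, ?_, ?_⟩, ?_⟩
      · intro y hy
        rw [ho] at hy
        exact List.formPerm_apply_of_notMem hy
      · rwa [ho]
      · exact Subtype.ext (congrArg (List.map Fin.val) ho)

end lastCycle

/-- for `n ≥ 2`, `t_n(213) = 2 F_{n+2} + n² − 6n + 4` as integers. -/
theorem t_n_213 (n : ℕ) (hn : 2 ≤ n) :
    (Nat.card {π : Equiv.Perm (Fin n) // Avoids π p213 ∧ Avoids (theta π) p213} : ℤ) =
      2 * Nat.fib (n + 2) + (n : ℤ) ^ 2 - 6 * (n : ℤ) + 4 := by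
  obtain ⟨t, rfl⟩ := Nat.exists_eq_add_of_le' hn
  rw [card_avoids, card_goodWords]
  push_cast
  ring
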